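/- Let G be a simple graph on a finite vertex set V, let w assign to each edge of G a strictly positive real weight, let e = {a,b} be an edge of G with weight w(e), and let G' be the graph obtained from G by deleting the edge e. Then for all vertices i and j, the weighted distance satisfies dist_G(i,j) = min{ dist_{G'}(i,j), dist_{G'}(i,a) + w(e) + dist_{G'}(b,j), dist_{G'}(i,b) + w(e) + dist_{G'}(a,j) }, where all distances are taken in the extended nonnegative reals (with value ∞ when no connecting walk exists). (This is the correctness of the dynamic-programming recursion D(i,j,h) = min{ D(i,j,h−1), D(i,a_h,h−1)+d(ℓ_h)+D(b_h,j,h−1), D(i,b_h,h−1)+d(ℓ_h)+D(a_h,j,h−1) } used by the paper's path-computation algorithm.) -/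

import Mathlib

open scoped ENNReal

/-- The weight of a walk: the sum of the weights of its edges, counted with multiplicity. -/
def walkWeight {V : Type*} {G : SimpleGraph V} (w : Sym2 V → ℝ) {x y : V}
    (p : G.Walk x y) : ℝ :=
  (p.edges.map w).sum

/-- The weighted distance between two vertices: the infimum, in the extended nonnegative
reals, of the weights of all connecting walks (`∞` when no walk exists). -/
noncomputable def wdist {V : Type*} (G : SimpleGraph V) (w : Sym2 V → ℝ) (x y : V) : ℝ≥0∞ :=
  ⨅ p : G.Walk x y, ENNReal.ofReal (walkWeight w p)

section WeightedDistance

variable {V : Type*} {G H : SimpleGraph V} {w : Sym2 V → ℝ}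

theorem wdist_le_walkWeight {x y : V} (p : G.Walk x y) :
    wdist G w x y ≤ ENNReal.ofReal (walkWeight w p) :=
  iInf_le _ p

theorem wdist_self (x : V) : wdist G w x x = 0 := by
  simpa [walkWeight] using wdist_le_walkWeight (w := w) (SimpleGraph.Walk.nil : G.Walk x x)

theorem wdist_triangle (x y z : V) : wdist G w x z ≤ wdist G w x y + wdist G w y z := by
  refine ENNReal.le_iInf_add_iInf fun p q => (wdist_le_walkWeight (p.append q)).trans ?_
  have h : walkWeight w (p.append q) = walkWeight w p + walkWeight w q := by simp [walkWeight]
  exact h ▸ ENNReal.ofReal_add_le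

theorem wdist_le_of_adj {x y : V} (h : G.Adj x y) :
    wdist G w x y ≤ ENNReal.ofReal (w s(x, y)) := by
  simpa [walkWeight] using wdist_le_walkWeight (w := w) h.toWalk

theorem wdist_anti (h : G ≤ H) (x y : V) : wdist H w x y ≤ wdist G w x y := by
  refine le_iInf fun p => (wdist_le_walkWeight (p.mapLe h)).trans_eq ?_
  simp [walkWeight]

theorem walkWeight_nonneg (hw : ∀ e ∈ G.edgeSet, 0 ≤ w e) {x y : V} (p : G.Walk x y) :
    0 ≤ walkWeight w p := by
  refine List.sum_nonneg fun r hr => ?_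
  obtain ⟨e, he, rfl⟩ := List.mem_map.1 hr
  exact hw e (p.edges_subset_edgeSet he)

theorem ofReal_walkWeight_cons (hw : ∀ e ∈ G.edgeSet, 0 ≤ w e) {x y z : V} (h : G.Adj x y)
    (p : G.Walk y z) :
    ENNReal.ofReal (walkWeight w (SimpleGraph.Walk.cons h p)) =
      ENNReal.ofReal (w s(x, y)) + ENNReal.ofReal (walkWeight w p) := by
  rw [← ENNReal.ofReal_add (hw s(x, y) h) (walkWeight_nonneg hw p)]
  simp [walkWeight]

/-- A walk costs at least as much as the best route using the edge `s(a, b)` at most once. -/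
theorem min_wdist_deleteEdges_le_walkWeight (hw : ∀ e ∈ G.edgeSet, 0 ≤ w e) (a b : V)
    {i j : V} (p : G.Walk i j) :
    min (wdist (G.deleteEdges {s(a, b)}) w i j)
        (min
          (wdist (G.deleteEdges {s(a, b)}) w i a + ENNReal.ofReal (w s(a, b)) +
            wdist (G.deleteEdges {s(a, b)}) w b j)
          (wdist (G.deleteEdges {s(a, b)}) w i b + ENNReal.ofReal (w s(a, b)) +
            wdist (G.deleteEdges {s(a, b)}) w a j)) ≤
      ENNReal.ofReal (walkWeight w p) := by
  induction p with
  | nil => simp [wdist_self]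
  | @cons u v j h p ih =>
    rw [ofReal_walkWeight_cons hw]
    refine le_trans ?_ (add_le_add_right ih _)
    rw [← min_add_add_left, ← min_add_add_left]
    by_cases he : s(u, v) = s(a, b)
    · rw [he]
      obtain ⟨rfl, rfl⟩ | ⟨rfl, rfl⟩ := Sym2.eq_iff.1 he
      · rw [wdist_self, wdist_self, zero_add]
        refine le_min (min_le_of_right_le (min_le_left _ _)) (le_min ?_ ?_)
        · exact min_le_of_right_le <| min_le_of_left_le <| add_le_add_right le_add_self _
        · exact min_le_of_left_le (le_add_self.trans le_add_self)
      · rw [wdist_self, wdist_self, zero_add]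
        refine le_min (min_le_of_right_le (min_le_right _ _)) (le_min ?_ ?_)
        · exact min_le_of_left_le (le_add_self.trans le_add_self)
        · exact min_le_of_right_le <| min_le_of_right_le <| add_le_add_right le_add_self _
    · have hstep (x : V) : wdist (G.deleteEdges {s(a, b)}) w u x ≤
          ENNReal.ofReal (w s(u, v)) + wdist (G.deleteEdges {s(a, b)}) w v x :=
        (wdist_triangle u v x).trans <| add_le_add_left
          (wdist_le_of_adj (SimpleGraph.deleteEdges_adj.2 ⟨h, he⟩)) _
      simp only [← add_assoc]
      gcongr <;> exact hstep _

theorem wdist_le_add_of_adj (hHG : H ≤ G) {a b : V} (hab : G.Adj a b) (i j : V) :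
    wdist G w i j ≤ wdist H w i a + ENNReal.ofReal (w s(a, b)) + wdist H w b j :=
  (wdist_triangle i b j).trans <| add_le_add
    ((wdist_triangle i a b).trans <| add_le_add (wdist_anti hHG i a) (wdist_le_of_adj hab))
    (wdist_anti hHG b j)

end WeightedDistance

/-- Correctness of the dynamic-programming recursion: with `G'` obtained from `G` by
deleting the edge `e = {a,b}`, for all vertices `i, j`:
`dist_G(i,j) = min { dist_{G'}(i,j), dist_{G'}(i,a) + w(e) + dist_{G'}(b,j),
dist_{G'}(i,b) + w(e) + dist_{G'}(a,j) }`. -/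
theorem dp_recursion_correct {V : Type*} [Fintype V] (G : SimpleGraph V)
    (w : Sym2 V → ℝ) (hw : ∀ e ∈ G.edgeSet, 0 < w e)
    (a b : V) (hab : G.Adj a b) :
    ∀ i j : V,
      wdist G w i j =
        min (wdist (G.deleteEdges {s(a, b)}) w i j)
          (min
            (wdist (G.deleteEdges {s(a, b)}) w i a + ENNReal.ofReal (w s(a, b)) +
              wdist (G.deleteEdges {s(a, b)}) w b j)
            (wdist (G.deleteEdges {s(a, b)}) w i b + ENNReal.ofReal (w s(a, b)) +
              wdist (G.deleteEdges {s(a, b)}) w a j)) := by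
  intro i j
  have hle : G.deleteEdges {s(a, b)} ≤ G := G.deleteEdges_le _
  refine le_antisymm (le_min (wdist_anti hle i j) (le_min ?_ ?_)) ?_
  · exact wdist_le_add_of_adj hle hab i j
  · rw [Sym2.eq_swap]
    rw [Sym2.eq_swap] at hle
    exact wdist_le_add_of_adj hle hab.symm i j
  · exact le_iInf fun p => min_wdist_deleteEdges_le_walkWeight (fun e he => (hw e he).le) a b p
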